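/- Let R be a commutative ring, V and W R-modules, and m a nonnegative integer. There exists an R-linear equivalence Φ : Λ^m(V ⊕ W) ≅ ⨁_{i=0}^{m} (Λ^i V ⊗ Λ^{m-i} W) which is equivariant: for all R-linear automorphisms e of V and f of W, Φ ∘ Λ^m(e ⊕ f) = (⨁_{i=0}^{m} (Λ^i e ⊗ Λ^{m-i} f)) ∘ Φ. -/

import Mathlib

open scoped TensorProduct

/-- The linear map `⋀[R]^k M →ₗ[R] ⋀[R]^k N` functorially induced on `k`-th exterior powers
by a linear map `f : M →ₗ[R] N`. -/
noncomputable def exteriorPowerMap {R : Type*} [CommRing R] {M N : Type*}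
    [AddCommGroup M] [Module R M] [AddCommGroup N] [Module R N]
    (k : ℕ) (f : M →ₗ[R] N) : ⋀[R]^k M →ₗ[R] ⋀[R]^k N :=
  (ExteriorAlgebra.map f).toLinearMap.restrict fun x hx => by
    have h1 : Submodule.map (ExteriorAlgebra.map f).toLinearMap (⋀[R]^k M)
        = (Submodule.map (ExteriorAlgebra.map f).toLinearMap
            (LinearMap.range (ExteriorAlgebra.ι R (M := M)))) ^ k :=
      Submodule.map_pow _ (ExteriorAlgebra.map f) k
    have h2 : (Submodule.map (ExteriorAlgebra.map f).toLinearMap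
            (LinearMap.range (ExteriorAlgebra.ι R (M := M)))) ^ k ≤ ⋀[R]^k N := by
      rw [ExteriorAlgebra.ι_range_map_map]
      exact pow_le_pow_left' ((Submodule.map_mono le_top).trans_eq (Submodule.map_top _)) k
    exact h2 (h1 ▸ Submodule.mem_map_of_mem hx)

namespace ExtProd

open DirectSum

section
variable (R : Type*) [CommRing R] (V W : Type*)
    [AddCommGroup V] [Module R V] [AddCommGroup W] [Module R W]

/-- The multiplication map `Λ V ⊗ Λ W → Λ (V × W)`. -/
noncomputable def mulMap : ExteriorAlgebra R V ⊗[R] ExteriorAlgebra R W →ₗ[R]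
    ExteriorAlgebra R (V × W) :=
  LinearMap.mul' R _ ∘ₗ TensorProduct.map
    (ExteriorAlgebra.map (LinearMap.inl R V W)).toLinearMap
    (ExteriorAlgebra.map (LinearMap.inr R V W)).toLinearMap

lemma mulMap_tmul (a : ExteriorAlgebra R V) (b : ExteriorAlgebra R W) :
    mulMap R V W (a ⊗ₜ b) = ExteriorAlgebra.map (LinearMap.inl R V W) a *
      ExteriorAlgebra.map (LinearMap.inr R V W) b := rfl

lemma mulMap_bijective : Function.Bijective (mulMap R V W) := by
  have h0 : ∀ x : V × W, (0 : QuadraticForm R (V × W)) x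
      = ((0 : QuadraticForm R V).prod (0 : QuadraticForm R W)) x := by
    intro x; simp
  let g : ((0 : QuadraticForm R V).prod (0 : QuadraticForm R W)).IsometryEquiv
      (0 : QuadraticForm R (V × W)) :=
    { LinearEquiv.refl R (V × W) with map_app' := fun x => h0 x }
  let T := (CliffordAlgebra.prodEquiv (0 : QuadraticForm R V) (0 : QuadraticForm R W)).symm.trans
    (CliffordAlgebra.equivOfIsometry g)
  have hT : ∀ z : ExteriorAlgebra R V ⊗[R] ExteriorAlgebra R W,
      mulMap R V W z = T (GradedTensorProduct.of R _ _ z) := by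
    have key : ∀ a b, mulMap R V W (a ⊗ₜ b) = T (GradedTensorProduct.of R _ _ (a ⊗ₜ b)) := by
      intro a b
      have h1 : (CliffordAlgebra.equivOfIsometry g).toAlgHom.comp
          (CliffordAlgebra.map (.inl (0 : QuadraticForm R V) (0 : QuadraticForm R W)))
          = ExteriorAlgebra.map (LinearMap.inl R V W) := by
        apply CliffordAlgebra.hom_ext
        ext x
        simp [ExteriorAlgebra.map, g]
        rfl
      have h2 : (CliffordAlgebra.equivOfIsometry g).toAlgHom.comp
          (CliffordAlgebra.map (.inr (0 : QuadraticForm R V) (0 : QuadraticForm R W)))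
          = ExteriorAlgebra.map (LinearMap.inr R V W) := by
        apply CliffordAlgebra.hom_ext
        ext x
        simp [ExteriorAlgebra.map, g]
        rfl
      rw [mulMap_tmul, ← h1, ← h2]
      exact (map_mul (CliffordAlgebra.equivOfIsometry g) _ _).symm
    intro z
    induction z using TensorProduct.induction_on with
    | zero => simp
    | tmul a b => exact key a b
    | add x y hx hy => rw [map_add, map_add, map_add, hx, hy]
  have : (mulMap R V W : _ → _) = T ∘ (GradedTensorProduct.of R _ _) := funext hT
  rw [this]
  exact T.bijective.comp (LinearEquiv.bijective _)

/-- Projection to a graded piece. -/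
noncomputable def pr (i : ℕ) : ExteriorAlgebra R V →ₗ[R] ⋀[R]^i V :=
  DirectSum.component R ℕ (fun i => ⋀[R]^i V) i ∘ₗ
    (DirectSum.decomposeLinearEquiv (fun i : ℕ => ⋀[R]^i V)).toLinearMap

lemma pr_apply (i : ℕ) (x : ExteriorAlgebra R V) :
    pr R V i x = DirectSum.decompose (fun i : ℕ => ⋀[R]^i V) x i := rfl

lemma pr_coe_same (i : ℕ) (x : ⋀[R]^i V) : pr R V i (x : ExteriorAlgebra R V) = x := by
  rw [pr_apply]
  exact Subtype.ext (DirectSum.decompose_of_mem_same _ x.2)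

lemma pr_coe_ne {i j : ℕ} (h : i ≠ j) (x : ⋀[R]^i V) :
    pr R V j (x : ExteriorAlgebra R V) = 0 := by
  rw [pr_apply]
  exact Subtype.ext (DirectSum.decompose_of_mem_ne _ x.2 h)

lemma map_mem {V W : Type*} [AddCommGroup V] [Module R V] [AddCommGroup W] [Module R W]
    (k : ℕ) (f : V →ₗ[R] W) (x : ⋀[R]^k V) :
    ExteriorAlgebra.map f (x : ExteriorAlgebra R V) ∈ ⋀[R]^k W :=
  (exteriorPowerMap k f x).2

lemma coe_exteriorPowerMap {V W : Type*} [AddCommGroup V] [Module R V] [AddCommGroup W]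
    [Module R W] (k : ℕ) (f : V →ₗ[R] W) (x : ⋀[R]^k V) :
    (exteriorPowerMap k f x : ExteriorAlgebra R W) = ExteriorAlgebra.map f x := rfl

/-- Inclusion of the graded tensor piece. -/
noncomputable def inc (i j : ℕ) : (⋀[R]^i V) ⊗[R] (⋀[R]^j W) →ₗ[R]
    ExteriorAlgebra R V ⊗[R] ExteriorAlgebra R W :=
  TensorProduct.map (⋀[R]^i V).subtype (⋀[R]^j W).subtype

lemma inc_mem (i j m : ℕ) (h : i + j = m) (z : (⋀[R]^i V) ⊗[R] (⋀[R]^j W)) :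
    (mulMap R V W ∘ₗ inc R V W i j) z ∈ ⋀[R]^m (V × W) := by
  subst h
  induction z using TensorProduct.induction_on with
  | zero => rw [map_zero]; exact Submodule.zero_mem _
  | tmul a b =>
    exact SetLike.mul_mem_graded (A := fun i : ℕ => ⋀[R]^i (V × W))
      (map_mem R i (LinearMap.inl R V W) a) (map_mem R j (LinearMap.inr R V W) b)
  | add x y hx hy => rw [map_add]; exact Submodule.add_mem _ hx hy

/-- The component maps. -/
noncomputable def comp (m : ℕ) (i : Fin (m + 1)) :
    (⋀[R]^(i : ℕ) V) ⊗[R] (⋀[R]^(m - (i : ℕ)) W) →ₗ[R] ⋀[R]^m (V × W) :=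
  LinearMap.codRestrict _ (mulMap R V W ∘ₗ inc R V W i (m - i))
    (inc_mem R V W i (m - i) m (by omega))

/-- The inverse decomposition map. -/
noncomputable def Psi (m : ℕ) :
    (Π i : Fin (m + 1), ((⋀[R]^(i : ℕ) V) ⊗[R] (⋀[R]^(m - (i : ℕ)) W))) →ₗ[R]
      ⋀[R]^m (V × W) :=
  LinearMap.lsum R _ R (comp R V W m)

lemma Psi_apply (m : ℕ) (x) : Psi R V W m x = ∑ i, comp R V W m i (x i) := by
  simp [Psi]

lemma Psi_coe (m : ℕ) (x) : (Psi R V W m x : ExteriorAlgebra R (V × W)) =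
    mulMap R V W (∑ i : Fin (m + 1), inc R V W i (m - i) (x i)) := by
  rw [Psi_apply, map_sum, AddSubmonoidClass.coe_finsetSum]
  rfl

lemma pr_inc_same (i j : ℕ) (z) :
    TensorProduct.map (pr R V i) (pr R W j) (inc R V W i j z) = z := by
  induction z using TensorProduct.induction_on with
  | zero => simp
  | tmul a b => simp [inc, pr_coe_same]
  | add x y hx hy => rw [map_add, map_add, hx, hy]

lemma pr_inc_ne (i j i' j' : ℕ) (h : i ≠ i') (z) :
    TensorProduct.map (pr R V i') (pr R W j') (inc R V W i j z) = 0 := by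
  induction z using TensorProduct.induction_on with
  | zero => simp
  | tmul a b => simp [inc, pr_coe_ne R V h]
  | add x y hx hy => rw [map_add, map_add, hx, hy, add_zero]

lemma Psi_injective (m : ℕ) : Function.Injective (Psi R V W m) := by
  rw [injective_iff_map_eq_zero]
  intro x hx
  have h1 := Psi_coe R V W m x
  rw [hx] at h1
  have h2 := (injective_iff_map_eq_zero _).1 (mulMap_bijective R V W).1 _ h1.symm
  funext i
  have h3 := congrArg (TensorProduct.map (pr R V i) (pr R W (m - i))) h2
  rw [map_sum, map_zero, Finset.sum_eq_single i, pr_inc_same] at h3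
  · exact h3
  · intro j _ hj
    exact pr_inc_ne R V W _ _ _ _ (fun h => hj (Fin.ext h)) _
  · simp

lemma pr_mulMap_mem (m : ℕ) (z) : pr R (V × W) m (mulMap R V W z) ∈
    LinearMap.range (Psi R V W m) := by
  induction z using TensorProduct.induction_on with
  | zero => rw [map_zero, map_zero]; exact Submodule.zero_mem _
  | add x y hx hy => rw [map_add, map_add]; exact Submodule.add_mem _ hx hy
  | tmul a b =>
    induction a using DirectSum.Decomposition.inductionOn (fun i : ℕ => ⋀[R]^i V) with
    | zero => rw [TensorProduct.zero_tmul, map_zero, map_zero]; exact Submodule.zero_mem _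
    | add x y hx hy =>
      rw [TensorProduct.add_tmul, map_add, map_add]; exact Submodule.add_mem _ hx hy
    | @homogeneous i a =>
      induction b using DirectSum.Decomposition.inductionOn (fun i : ℕ => ⋀[R]^i W) with
      | zero => rw [TensorProduct.tmul_zero, map_zero, map_zero]; exact Submodule.zero_mem _
      | add x y hx hy =>
        rw [TensorProduct.tmul_add, map_add, map_add]; exact Submodule.add_mem _ hx hy
      | @homogeneous j b =>
        have hm := inc_mem R V W i j (i + j) rfl (a ⊗ₜ b)
        by_cases h : i + j = m
        · obtain rfl : j = m - i := by omega
          have hi : i < m + 1 := by omega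
          refine ⟨Pi.single ⟨i, hi⟩ (a ⊗ₜ b), ?_⟩
          have e : Psi R V W m (Pi.single ⟨i, hi⟩ (a ⊗ₜ b)) = comp R V W m ⟨i, hi⟩ (a ⊗ₜ b) := by
            rw [Psi_apply, Finset.sum_eq_single ⟨i, hi⟩]
            · rw [Pi.single_eq_same]
            · intro k _ hk
              rw [Pi.single_eq_of_ne hk, map_zero]
            · simp
          rw [e]
          exact (pr_coe_same R (V × W) m (comp R V W m ⟨i, hi⟩ (a ⊗ₜ b))).symm
        · have := pr_coe_ne R (V × W) h ⟨_, hm⟩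
          have e : pr R (V × W) m (mulMap R V W ((a : ExteriorAlgebra R V) ⊗ₜ
            (b : ExteriorAlgebra R W))) = 0 := this
          rw [e]
          exact Submodule.zero_mem _

lemma Psi_surjective (m : ℕ) : Function.Surjective (Psi R V W m) := by
  intro y
  obtain ⟨z, hz⟩ := (mulMap_bijective R V W).2 (y : ExteriorAlgebra R (V × W))
  have := pr_mulMap_mem R V W m z
  rw [hz, pr_coe_same] at this
  exact this

lemma Psi_bijective (m : ℕ) : Function.Bijective (Psi R V W m) :=
  ⟨Psi_injective R V W m, Psi_surjective R V W m⟩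

variable {V W} in
lemma comp_equivariant (m : ℕ) (i : Fin (m + 1)) (e : V →ₗ[R] V) (f : W →ₗ[R] W) (z) :
    exteriorPowerMap m (LinearMap.prodMap e f) (comp R V W m i z) =
      comp R V W m i (TensorProduct.map (exteriorPowerMap (i : ℕ) e)
        (exteriorPowerMap (m - (i : ℕ)) f) z) := by
  induction z using TensorProduct.induction_on with
  | zero => simp only [map_zero]
  | add x y hx hy => simp only [map_add, hx, hy]
  | tmul a b =>
    apply Subtype.ext
    change ExteriorAlgebra.map (LinearMap.prodMap e f)
        (ExteriorAlgebra.map (LinearMap.inl R V W) (a : ExteriorAlgebra R V) *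
          ExteriorAlgebra.map (LinearMap.inr R V W) (b : ExteriorAlgebra R W)) =
      ExteriorAlgebra.map (LinearMap.inl R V W)
          (ExteriorAlgebra.map e (a : ExteriorAlgebra R V)) *
        ExteriorAlgebra.map (LinearMap.inr R V W)
          (ExteriorAlgebra.map f (b : ExteriorAlgebra R W))
    rw [map_mul]
    simp only [← AlgHom.comp_apply, ExteriorAlgebra.map_comp_map]
    congr 3
    · congr 1
      ext <;> simp
    · congr 1
      ext <;> simp

end
end ExtProd

/-- There is an equivariant `R`-linear equivalence
`Λ^m(V ⊕ W) ≅ ⨁_{i=0}^{m} (Λ^i V ⊗ Λ^{m-i} W)` (the finite direct sum being realized as the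
product over `i : Fin (m+1)`): it intertwines `Λ^m(e ⊕ f)` with
`⨁_{i=0}^{m} (Λ^i e ⊗ Λ^{m-i} f)` for all linear automorphisms `e` of `V` and `f` of `W`. -/
theorem exteriorPower_prod_equivariant_decomposition
    (R : Type*) [CommRing R] (V W : Type*)
    [AddCommGroup V] [Module R V] [AddCommGroup W] [Module R W] (m : ℕ) :
    ∃ Φ : (⋀[R]^m (V × W)) ≃ₗ[R]
        (Π i : Fin (m + 1), ((⋀[R]^(i : ℕ) V) ⊗[R] (⋀[R]^(m - (i : ℕ)) W))),
      ∀ (e : V ≃ₗ[R] V) (f : W ≃ₗ[R] W),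
        Φ.toLinearMap ∘ₗ exteriorPowerMap m (LinearMap.prodMap e.toLinearMap f.toLinearMap) =
          (LinearMap.pi fun i : Fin (m + 1) =>
            (TensorProduct.map (exteriorPowerMap (i : ℕ) e.toLinearMap)
                (exteriorPowerMap (m - (i : ℕ)) f.toLinearMap)) ∘ₗ
              LinearMap.proj i) ∘ₗ Φ.toLinearMap := by
  refine ⟨(LinearEquiv.ofBijective (ExtProd.Psi R V W m)
    (ExtProd.Psi_bijective R V W m)).symm, fun e f => ?_⟩
  apply LinearMap.ext
  intro y
  obtain ⟨x, rfl⟩ := (LinearEquiv.ofBijective (ExtProd.Psi R V W m)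
    (ExtProd.Psi_bijective R V W m)).surjective y
  simp only [LinearMap.comp_apply, LinearEquiv.coe_coe, LinearEquiv.symm_apply_apply]
  rw [LinearEquiv.symm_apply_eq]
  simp only [LinearEquiv.ofBijective_apply, ExtProd.Psi_apply, map_sum]
  refine Finset.sum_congr rfl fun i _ => ?_
  exact ExtProd.comp_equivariant R m i e.toLinearMap f.toLinearMap (x i)
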